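/- (Closed-form detection threshold minimizing the total error probability) Let τ be a positive integer and g, σ² > 0. Define f : (0, ∞) → ℝ by f(ζ) = exp(−ζ/(τσ²)) + 1 − exp(−ζ/(τ²g + τσ²)), i.e., f(ζ) = P₁₀(ζ) + P₀₁(ζ) is the sum of the false-detection and missed-detection probabilities at threshold ζ. Let ζ* = (σ²(τg + σ²)/g) · ln((σ² + τg)/σ²). Then ζ* > 0 and ζ* is the unique global minimizer of f on (0, ∞); that is, f(ζ) > f(ζ*) for every ζ > 0 with ζ ≠ ζ*. -/

import Mathlib

noncomputable section

/-- If `x / a - x / b = log (b / a)` with `0 < a < b`, then `x` is the strict global minimizer of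
`y ↦ exp (-y / a) + 1 - exp (-y / b)`. -/
theorem exp_neg_div_add_one_sub_exp_neg_div_lt {a b x y : ℝ} (ha : 0 < a) (hab : a < b)
    (hx : x / a - x / b = Real.log (b / a)) (hy : y ≠ x) :
    Real.exp (-x / a) + 1 - Real.exp (-x / b) < Real.exp (-y / a) + 1 - Real.exp (-y / b) := by
  have hb : 0 < b := ha.trans hab
  have hxb : Real.exp (-x / b) = b / a * Real.exp (-x / a) := by
    rw [← Real.exp_log (div_pos hb ha), ← Real.exp_add, ← hx]
    congr 1
    ring
  have hu : (x - y) / b ≠ 0 := div_ne_zero (sub_ne_zero.2 hy.symm) hb.ne'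
  have bernoulli := one_add_mul_self_lt_rpow_one_add (s := Real.exp ((x - y) / b) - 1)
    (by linarith [Real.exp_pos ((x - y) / b)])
    (sub_ne_zero.2 (mt (Real.exp_eq_one_iff _).1 hu)) ((one_lt_div ha).2 hab)
  rw [add_sub_cancel, ← Real.exp_mul] at bernoulli
  have hya : Real.exp (-y / a) = Real.exp (-x / a) * Real.exp ((x - y) / b * (b / a)) := by
    rw [← Real.exp_add]
    congr 1
    field_simp
    ring
  have hyb : Real.exp (-y / b) = b / a * Real.exp (-x / a) * Real.exp ((x - y) / b) := by
    rw [← hxb, ← Real.exp_add]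
    congr 1
    ring
  rw [hya, hyb, hxb]
  linarith [mul_lt_mul_of_pos_left bernoulli (Real.exp_pos (-x / a))]

/-- The closed-form detection threshold
`ζ* = (σ²(τg + σ²)/g) · ln((σ² + τg)/σ²)` is positive and is the unique global
minimizer on `(0, ∞)` of the total error probability
`f(ζ) = P₁₀(ζ) + P₀₁(ζ) = exp(−ζ/(τσ²)) + 1 − exp(−ζ/(τ²g + τσ²))`. -/
theorem optimal_threshold_minimizes_total_error
    (τ : ℕ) (hτ : 0 < τ) (g σ2 : ℝ) (hg : 0 < g) (hσ : 0 < σ2) :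
    0 < σ2 * (τ * g + σ2) / g * Real.log ((σ2 + τ * g) / σ2) ∧
    ∀ ζ : ℝ, 0 < ζ → ζ ≠ σ2 * (τ * g + σ2) / g * Real.log ((σ2 + τ * g) / σ2) →
      (Real.exp (-(σ2 * (τ * g + σ2) / g * Real.log ((σ2 + τ * g) / σ2)) / (τ * σ2)) +
          1 -
          Real.exp (-(σ2 * (τ * g + σ2) / g * Real.log ((σ2 + τ * g) / σ2)) /
            ((τ : ℝ) ^ 2 * g + τ * σ2))) <
        Real.exp (-ζ / (τ * σ2)) + 1 - Real.exp (-ζ / ((τ : ℝ) ^ 2 * g + τ * σ2)) := by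
  have ht : (0 : ℝ) < τ := Nat.cast_pos.2 hτ
  have hlog : 0 < Real.log ((σ2 + τ * g) / σ2) :=
    Real.log_pos ((one_lt_div hσ).2 (lt_add_of_pos_right _ (by positivity)))
  refine ⟨by positivity, fun ζ _ hne => ?_⟩
  refine exp_neg_div_add_one_sub_exp_neg_div_lt (by positivity)
    (lt_add_of_pos_left _ (by positivity)) ?_ hne
  have hratio : ((τ : ℝ) ^ 2 * g + τ * σ2) / (τ * σ2) = (σ2 + τ * g) / σ2 := by
    field_simp
    ring
  rw [hratio]
  have hsum : (τ : ℝ) * g + σ2 ≠ 0 := by positivity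
  have hfactor : (τ : ℝ) ^ 2 * g + τ * σ2 = τ * (τ * g + σ2) := by ring
  rw [hfactor]
  generalize Real.log ((σ2 + τ * g) / σ2) = L
  field_simp
  ring
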